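/- Let Σ be an N×N real symmetric positive definite matrix such that every entry of Σ^{-1} is nonnegative, and write σ^{k,k} for the k-th diagonal entry of Σ^{-1} (each σ^{k,k} > 0). Let X = (X_1,…,X_N) be a centered Gaussian vector with covariance matrix Σ. Then P(X_k > 0 for all 1 ≤ k ≤ N) ≤ 1 / (2^N √(det Σ) Π_{k=1}^N √(σ^{k,k})). -/

import Mathlib

open MeasureTheory ProbabilityTheory Matrix

noncomputable section

/-- Normalized Lebesgue measure `λ` on `T = [-π,π]`, with `λ(T) = 1`. -/
def normLeb1 : Measure ℝ :=
  (ENNReal.ofReal (2 * Real.pi))⁻¹ • (volume.restrict (Set.Icc (-Real.pi) Real.pi))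

/-- Fourier coefficient `μ̂(m) = ∫_T e^{imt} dμ(t)` for `m ∈ ℤ`. -/
def muHat1 (μ : Measure ℝ) (m : ℤ) : ℂ :=
  ∫ t, Complex.exp (Complex.I * (m : ℂ) * (t : ℂ)) ∂μ

/-- The matrix `Σ_N = (μ̂(j-k))_{1 ≤ j,k ≤ N}` (real, since `μ` is symmetric). -/
def SigmaN (μ : Measure ℝ) (N : ℕ) : Matrix (Fin N) (Fin N) ℝ :=
  fun j k => (muHat1 μ ((j.1 : ℤ) - (k.1 : ℤ))).re

/-- `X` is a centered Gaussian vector with covariance matrix `S` (under `P`):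
every linear combination of the coordinates is a centered one-dimensional
Gaussian with the corresponding variance. -/
def IsCenteredGaussianVec {ι : Type*} [Fintype ι] {Ω : Type*} [MeasurableSpace Ω]
    (P : Measure Ω) (X : ι → Ω → ℝ) (S : Matrix ι ι ℝ) : Prop :=
  ∀ u : ι → ℝ,
    P.map (fun ω => ∑ i, u i * X i ω) =
      gaussianReal 0 (Real.toNNReal (u ⬝ᵥ S.mulVec u))

open scoped MatrixOrder Matrix.Norms.L2Operator

lemma aux_pi_dens {ι : Type*} [Fintype ι] (v : ι → NNReal) (hv : ∀ i, v i ≠ 0) :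
    Measure.pi (fun i => gaussianReal 0 (v i)) =
      (volume : Measure (ι → ℝ)).withDensity
        (fun x => ENNReal.ofReal (∏ i, gaussianPDFReal 0 (v i) (x i))) := by
  refine Measure.pi_eq fun s hs => ?_
  rw [withDensity_apply _ (MeasurableSet.univ_pi hs), volume_pi, Measure.restrict_pi_pi]
  have hint : Integrable (fun x : ι → ℝ => ∏ i, gaussianPDFReal 0 (v i) (x i))
      (Measure.pi fun i => (volume : Measure ℝ).restrict (s i)) :=
    Integrable.fintype_prod (f := fun i => gaussianPDFReal 0 (v i))
      (fun i => (integrable_gaussianPDFReal 0 (v i)).restrict)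
  rw [← ofReal_integral_eq_lintegral_ofReal hint
    (ae_of_all _ fun x => Finset.prod_nonneg fun i _ => gaussianPDFReal_nonneg _ _ _)]
  rw [integral_fintype_prod_eq_prod (f := fun i => gaussianPDFReal 0 (v i)),
    ENNReal.ofReal_prod_of_nonneg]
  · exact Finset.prod_congr rfl fun i _ => (gaussianReal_apply_eq_integral _ (hv i) _).symm
  · exact fun i _ => integral_nonneg fun x => gaussianPDFReal_nonneg _ _ _

lemma aux_half (v : NNReal) : gaussianReal 0 v (Set.Ioi 0) ≤ 2⁻¹ := by
  have h1 : gaussianReal 0 v (Set.Iio 0) = gaussianReal 0 v (Set.Ioi 0) := by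
    conv_lhs => rw [← neg_zero, ← gaussianReal_map_neg, Measure.map_apply (by fun_prop) measurableSet_Iio]
    congr 1
    ext x; simp
  have h2 : gaussianReal 0 v (Set.Iio 0) + gaussianReal 0 v (Set.Ioi 0) ≤ 1 := by
    rw [← measure_union _ measurableSet_Ioi]
    · exact prob_le_one
    · rw [Set.disjoint_left]; intro x hx hx'; simp at hx hx'; linarith
  rw [h1, ← two_mul] at h2
  rw [ENNReal.le_inv_iff_mul_le, mul_comm]; exact h2

lemma aux_law {N : ℕ} (S : Matrix (Fin N) (Fin N) ℝ) (hS : S.PosDef)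
    {Ω : Type} [MeasurableSpace Ω] (P : Measure Ω) [IsProbabilityMeasure P]
    (X : Fin N → Ω → ℝ) (hX : IsCenteredGaussianVec P X S) :
    P {ω | ∀ k : Fin N, 0 < X k ω} =
      Measure.pi (fun _ : Fin N => gaussianReal 0 1)
        {x | ∀ k, 0 < (CFC.sqrt S *ᵥ x) k} := by
  have hm : ∀ k, AEMeasurable (X k) P := by
    intro k
    by_contra hk
    have := hX (Pi.single k 1)
    simp only [Pi.single_apply, ite_mul, one_mul, zero_mul, Finset.sum_ite_eq', Finset.mem_univ, if_true] at this
    rw [Measure.map_of_not_aemeasurable (by simpa using hk)] at this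
    exact IsProbabilityMeasure.ne_zero _ this.symm
  have hmX : AEMeasurable (fun ω => WithLp.toLp 2 (fun k => X k ω)) P :=
    (by fun_prop : Measurable (WithLp.toLp 2 : (Fin N → ℝ) → EuclideanSpace ℝ (Fin N))).comp_aemeasurable
      (aemeasurable_pi_lambda _ hm)
  have key : P.map (fun ω => WithLp.toLp 2 (fun k => X k ω)) = multivariateGaussian 0 S := by
    have : IsProbabilityMeasure (P.map (fun ω => WithLp.toLp 2 (fun k => X k ω))) :=
      Measure.isProbabilityMeasure_map hmX
    apply Measure.ext_of_charFun (E := EuclideanSpace ℝ (Fin N))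
    ext t
    rw [charFun_multivariateGaussian hS.posSemidef]
    have hms : AEMeasurable (fun ω => ∑ i, t.ofLp i * X i ω) P :=
      Finset.aemeasurable_fun_sum _ fun i _ => (hm i).const_mul _
    have h := congrArg (fun m => charFun m 1) (hX t.ofLp)
    simp only [charFun_gaussianReal] at h
    rw [charFun_apply, integral_map hms (by fun_prop)] at h
    rw [charFun_apply, integral_map hmX (by fun_prop)]
    have hnn : 0 ≤ t.ofLp ⬝ᵥ S *ᵥ t.ofLp := by
      simpa using hS.posSemidef.dotProduct_mulVec_nonneg t.ofLp
    rw [Real.coe_toNNReal _ hnn] at h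
    simpa [PiLp.inner_apply, neg_div] using h
  have hset : MeasurableSet {y : EuclideanSpace ℝ (Fin N) | ∀ k, 0 < y k} := by
    simp only [Set.ofPred_forall]
    exact MeasurableSet.iInter fun k => measurableSet_lt (by fun_prop) (by fun_prop)
  have h1 : P {ω | ∀ k : Fin N, 0 < X k ω} =
      multivariateGaussian 0 S {y : EuclideanSpace ℝ (Fin N) | ∀ k, 0 < y k} := by
    rw [← key, Measure.map_apply_of_aemeasurable hmX hset]; rfl
  rw [h1, multivariateGaussian, ← map_pi_eq_stdGaussian, Measure.map_map (by fun_prop) (by fun_prop),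
    Measure.map_apply (by fun_prop) hset]
  congr 1
  ext x
  simp

lemma aux_quad {N : ℕ} (T : Matrix (Fin N) (Fin N) ℝ) (hT : ∀ i j, 0 ≤ T i j)
    (u : Fin N → ℝ) (hu : ∀ i, 0 < u i) : ∑ k, T k k * u k ^ 2 ≤ u ⬝ᵥ T *ᵥ u := by
  simp only [dotProduct, mulVec, Finset.mul_sum]
  refine Finset.sum_le_sum fun k _ => ?_
  refine le_trans (le_of_eq ?_) (Finset.single_le_sum (f := fun j => u k * (T k j * u j))
    (fun j _ => mul_nonneg (hu k).le (mul_nonneg (hT _ _) (hu j).le)) (Finset.mem_univ k))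
  ring

/-- If every entry of `Σ^{-1}` is nonnegative, then the centered
Gaussian vector with covariance `Σ` satisfies
`P(X_k > 0 ∀k) ≤ 1 / (2^N √(det Σ) Π_k √(σ^{k,k}))`. -/
theorem gaussian_orthant_upper_bound
    (N : ℕ) (hN : 1 ≤ N) (S : Matrix (Fin N) (Fin N) ℝ) (hS : S.PosDef)
    (hinv : ∀ i j, 0 ≤ S⁻¹ i j)
    (Ω : Type) [MeasurableSpace Ω] (P : Measure Ω) [IsProbabilityMeasure P]
    (X : Fin N → Ω → ℝ) (hX : IsCenteredGaussianVec P X S) :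
    P {ω | ∀ k : Fin N, 0 < X k ω} ≤
      ENNReal.ofReal
        (1 / (2 ^ N * Real.sqrt S.det * ∏ k : Fin N, Real.sqrt (S⁻¹ k k))) := by
  rw [aux_law S hS P X hX]
  set B := CFC.sqrt S with hB
  have hBB : B * B = S := CFC.sqrt_mul_sqrt_self _ hS.posSemidef.nonneg
  have hBsymm : Bᵀ = B := by
    have := (CFC.sqrt_nonneg S).isSelfAdjoint
    rw [← conjTranspose_eq_transpose_of_trivial]; exact this
  have hdet : B.det * B.det = S.det := by rw [← det_mul, hBB]
  have hdS := hS.det_pos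
  have hdB : B.det ≠ 0 := by intro h; rw [h] at hdet; simp at hdet; linarith
  have habs : |B.det| = √S.det := by rw [← hdet, Real.sqrt_mul_self_eq_abs]
  have hpos : ∀ k, 0 < S⁻¹ k k := fun k => hS.inv.diag_pos
  set v : Fin N → NNReal := fun k => (Real.toNNReal (S⁻¹ k k))⁻¹ with hv
  have hv0 : ∀ k, v k ≠ 0 := fun k => inv_ne_zero (by simpa using hpos k)
  have hvr : ∀ k, (v k : ℝ) = (S⁻¹ k k)⁻¹ := fun k => by simp [hv, (hpos k).le]
  have hdBi : (B⁻¹).det ≠ 0 := by rw [det_nonsing_inv]; simpa using hdB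
  have hset : MeasurableSet {y : Fin N → ℝ | ∀ k, 0 < y k} := by
    simp only [Set.ofPred_forall]
    exact MeasurableSet.iInter fun k => measurableSet_lt (by fun_prop) (by fun_prop)
  have hmB : Measurable (fun x => B *ᵥ x) := (Matrix.toLin' B).continuous_of_finiteDimensional.measurable
  have hmBi : Measurable (fun x => B⁻¹ *ᵥ x) := (Matrix.toLin' B⁻¹).continuous_of_finiteDimensional.measurable
  have hset2 : MeasurableSet {x : Fin N → ℝ | ∀ k, 0 < (B *ᵥ x) k} := hmB hset
  rw [aux_pi_dens (fun _ => 1) (fun _ => one_ne_zero), withDensity_apply _ hset2]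
  -- change of variables
  have hvol : (volume : Measure (Fin N → ℝ)) =
      ENNReal.ofReal (|B.det|⁻¹) • Measure.map (fun x => B⁻¹ *ᵥ x) volume := by
    have h := Real.map_matrix_volume_pi_eq_smul_volume_pi hdBi
    have h' : Measure.map (fun x => B⁻¹ *ᵥ x) (volume : Measure (Fin N → ℝ)) = _ := h
    rw [h', smul_smul, ← ENNReal.ofReal_mul (by positivity), det_nonsing_inv]
    simp [hdB]
  have hmf : Measurable (fun x : Fin N → ℝ => ENNReal.ofReal (∏ i, gaussianPDFReal 0 1 (x i))) := by
    fun_prop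
  rw [hvol, Measure.restrict_smul, lintegral_smul_measure, Measure.restrict_map hmBi hset2,
    lintegral_map hmf hmBi]
  have hpre : (fun x => B⁻¹ *ᵥ x) ⁻¹' {x : Fin N → ℝ | ∀ k, 0 < (B *ᵥ x) k} = {y | ∀ k, 0 < y k} := by
    ext x
    simp [mulVec_mulVec, mul_nonsing_inv _ (isUnit_iff_ne_zero.2 hdB)]
  rw [hpre]
  have hbound : ∀ x ∈ {y : Fin N → ℝ | ∀ k, 0 < y k},
      ENNReal.ofReal (∏ i, gaussianPDFReal 0 1 ((B⁻¹ *ᵥ x) i)) ≤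
      ENNReal.ofReal ((∏ k, √(S⁻¹ k k))⁻¹) *
        ENNReal.ofReal (∏ i, gaussianPDFReal 0 (v i) (x i)) := by
    intro x hx
    rw [← ENNReal.ofReal_mul (by positivity)]
    apply ENNReal.ofReal_le_ofReal
    have hq := aux_quad S⁻¹ hinv x hx
    have hq2 : x ⬝ᵥ S⁻¹ *ᵥ x = ∑ i, (B⁻¹ *ᵥ x) i ^ 2 := by
      have : (B⁻¹)ᵀ = B⁻¹ := by rw [transpose_nonsing_inv, hBsymm]
      rw [← hBB, Matrix.mul_inv_rev, ← mulVec_mulVec, dotProduct_mulVec, ← mulVec_transpose, this]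
      simp [dotProduct, sq]
    rw [hq2] at hq
    simp only [gaussianPDFReal, Finset.prod_mul_distrib, ← Real.exp_sum, hvr]
    have e1 : (∏ k, √(S⁻¹ k k))⁻¹ * ((∏ i, (√(2 * Real.pi * (S⁻¹ i i)⁻¹))⁻¹) *
        Real.exp (∑ i, -(x i - 0) ^ 2 / (2 * (S⁻¹ i i)⁻¹))) =
        (∏ i : Fin N, (√(2 * Real.pi))⁻¹) * Real.exp (∑ i, -(x i - 0) ^ 2 / (2 * (S⁻¹ i i)⁻¹)) := by
      rw [← mul_assoc, ← Finset.prod_inv_distrib, ← Finset.prod_mul_distrib]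
      congr 1
      refine Finset.prod_congr rfl fun i _ => ?_
      rw [← mul_inv, ← Real.sqrt_mul (hpos i).le]
      congr 2
      have := (hpos i).ne'
      field_simp
    rw [e1]
    simp only [NNReal.coe_one, mul_one]
    refine mul_le_mul_of_nonneg_left (Real.exp_le_exp.2 ?_) (by positivity)
    have e2 : ∑ i, -((B⁻¹ *ᵥ x) i - 0) ^ 2 / 2 = -(∑ i, (B⁻¹ *ᵥ x) i ^ 2) / 2 := by
      simp [Finset.sum_div, neg_div]
    have e3 : ∑ i, -(x i - 0) ^ 2 / (2 * (S⁻¹ i i)⁻¹) = -(∑ i, S⁻¹ i i * x i ^ 2) / 2 := by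
      rw [neg_div, Finset.sum_div, ← Finset.sum_neg_distrib]
      refine Finset.sum_congr rfl fun i _ => ?_
      have := (hpos i).ne'
      field_simp
      ring
    rw [e2, e3]
    linarith
  have hbox : {y : Fin N → ℝ | ∀ k, 0 < y k} = Set.univ.pi (fun _ => Set.Ioi 0) := by
    ext; simp
  calc _ ≤ ENNReal.ofReal (|B.det|⁻¹) * ∫⁻ x in {y : Fin N → ℝ | ∀ k, 0 < y k},
        ENNReal.ofReal ((∏ k, √(S⁻¹ k k))⁻¹) *
        ENNReal.ofReal (∏ i, gaussianPDFReal 0 (v i) (x i)) := by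
        exact mul_le_mul_right (setLIntegral_mono' hset hbound) _
    _ = ENNReal.ofReal (|B.det|⁻¹) * (ENNReal.ofReal ((∏ k, √(S⁻¹ k k))⁻¹) *
        Measure.pi (fun i => gaussianReal 0 (v i)) {y : Fin N → ℝ | ∀ k, 0 < y k}) := by
        rw [lintegral_const_mul' _ _ ENNReal.ofReal_ne_top, aux_pi_dens v hv0,
          withDensity_apply _ hset]
    _ ≤ ENNReal.ofReal (|B.det|⁻¹) * (ENNReal.ofReal ((∏ k, √(S⁻¹ k k))⁻¹) *
        ENNReal.ofReal ((2 ^ N)⁻¹)) := by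
        gcongr
        rw [hbox, Measure.pi_pi]
        refine (Finset.prod_le_prod' fun i _ => aux_half (v i)).trans (le_of_eq ?_)
        rw [ENNReal.ofReal_inv_of_pos (by positivity), ENNReal.ofReal_pow (by norm_num)]
        simp [ENNReal.inv_pow]
    _ = _ := by
        rw [← ENNReal.ofReal_mul (by positivity), ← ENNReal.ofReal_mul (by positivity), habs]
        congr 1
        rw [one_div, mul_inv, mul_inv]
        ring
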